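/- Under the sector setup (see context), write p = λu + μv with λ, μ > 0. Suppose |C|·|C*| ≤ (1+ε)·|[o,u,v,p]|·|[o,u*,v*]| for some ε with 0 < ε < min{λ,μ}/(λ+μ). Set γ := 3·[(λ+μ)/min{λ,μ}]·(1+√(λ+μ)). Then either C ⊆ (1+γε)·[o,u,v], or (1+γε)^{-1}·[o,u,v,p] ⊆ C (the latter being equivalent to C* ⊆ (1+γε)·[o,u*,v*]). -/

import Mathlib

open MeasureTheory Pointwise Real
open scoped RealInnerProductSpace

/-- Area (two-dimensional Lebesgue measure) of a subset of the plane `ℂ ≅ ℝ²`. -/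
noncomputable def area (K : Set ℂ) : ℝ := (volume K).toReal

/-- The polar body `K* = {x : ⟨x,y⟩ ≤ 1 for all y ∈ K}`. -/
def polarBody (K : Set ℂ) : Set ℂ := {x | ∀ y ∈ K, ⟪x, y⟫ ≤ 1}

/-- A convex body: a compact convex set with nonempty interior. -/
def IsConvexBody (K : Set ℂ) : Prop := Convex ℝ K ∧ IsCompact K ∧ (interior K).Nonempty


section Triangle

lemma area_nonneg (K : Set ℂ) : 0 ≤ area K := ENNReal.toReal_nonneg

/-- The oriented area form on `ℂ`. -/
def crossForm (x y : ℂ) : ℝ := x.re * y.im - x.im * y.re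

/-- The real linear map sending `1` to `x` and `I` to `y`. -/
noncomputable def frameMap (x y : ℂ) : ℂ →ₗ[ℝ] ℂ :=
  Complex.reLm.smulRight x + Complex.imLm.smulRight y

lemma frameMap_apply (x y z : ℂ) : frameMap x y z = z.re • x + z.im • y := rfl

lemma det_frameMap (x y : ℂ) : LinearMap.det (frameMap x y) = crossForm x y := by
  rw [← LinearMap.det_toMatrix Complex.basisOneI, Matrix.det_fin_two]
  simp [LinearMap.toMatrix_apply, frameMap_apply, crossForm]
  ring

lemma area_convexHull_triple (a b c : ℂ) :
    area (convexHull ℝ {a, b, c}) =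
      |crossForm (b - a) (c - a)| * area (convexHull ℝ {0, 1, Complex.I}) := by
  have h : convexHull ℝ ({a, b, c} : Set ℂ) =
      a +ᵥ (frameMap (b - a) (c - a) '' convexHull ℝ {0, 1, Complex.I}) := by
    rw [LinearMap.image_convexHull, ← convexHull_vadd]
    congr 1
    simp [Set.image_insert_eq, frameMap_apply, Set.vadd_set_insert]
  unfold area
  rw [h, measure_vadd, Measure.addHaar_image_linearMap, det_frameMap, ENNReal.toReal_mul,
    ENNReal.toReal_ofReal (abs_nonneg _)]

lemma area_standard_triangle_pos : 0 < area (convexHull ℝ {(0 : ℂ), 1, Complex.I}) := by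
  have hfin : volume (convexHull ℝ {(0 : ℂ), 1, Complex.I}) ≠ ⊤ :=
    (Set.Finite.isCompact_convexHull ℝ (Set.toFinite _)).measure_lt_top.ne
  refine ENNReal.toReal_pos ?_ hfin
  have hsub : {z : ℂ | 0 < z.re ∧ 0 < z.im ∧ z.re + z.im < 1} ⊆
      convexHull ℝ {(0 : ℂ), 1, Complex.I} := by
    rintro z ⟨h1, h2, h3⟩
    rw [convexHull_insert (by simp), convexHull_pair]
    simp only [convexJoin_singleton_left, Set.mem_iUnion]
    refine ⟨(z.re / (z.re + z.im)) • 1 + (z.im / (z.re + z.im)) • Complex.I,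
      ⟨_, _, by positivity, by positivity, by field_simp, rfl⟩,
      1 - (z.re + z.im), z.re + z.im, by linarith, by linarith, by ring, ?_⟩
    have : z.re + z.im ≠ 0 := by positivity
    apply Complex.ext
    · simp [-Complex.ofReal_add, -Complex.ofReal_div]
      field_simp
    · simp [-Complex.ofReal_add, -Complex.ofReal_div]
      field_simp
  have hopen : IsOpen {z : ℂ | 0 < z.re ∧ 0 < z.im ∧ z.re + z.im < 1} := by
    refine (isOpen_lt continuous_const Complex.continuous_re).inter
      ((isOpen_lt continuous_const Complex.continuous_im).inter
        (isOpen_lt (Complex.continuous_re.add Complex.continuous_im) continuous_const))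
  have hpos := hopen.measure_pos volume ⟨⟨1 / 4, 1 / 4⟩, by norm_num⟩
  exact (hpos.trans_le (measure_mono hsub)).ne'

lemma inner_eq_re_im (x y : ℂ) : ⟪x, y⟫ = x.re * y.re + x.im * y.im := by
  simp [Complex.inner]
  ring

lemma area_triangle_beyond (f a b w : ℂ) (ha : ⟪f, a⟫ = 1) (hb : ⟪f, b⟫ = 1)
    (hw : 1 ≤ ⟪f, w⟫) :
    area (convexHull ℝ {a, b, w}) = (⟪f, w⟫ - 1) * area (convexHull ℝ {0, a, b}) := by
  rw [area_convexHull_triple, area_convexHull_triple 0 a]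
  have h : crossForm (b - a) (w - a) = -((⟪f, w⟫ - 1) * crossForm (a - 0) (b - 0)) := by
    rw [inner_eq_re_im] at *
    simp only [crossForm, Complex.sub_re, Complex.sub_im, sub_zero]
    linear_combination (w.re * b.im - w.im * b.re) * ha + (a.re * w.im - a.im * w.re) * hb
  rw [h, abs_neg, abs_mul, abs_of_nonneg (sub_nonneg.2 hw), mul_assoc]

lemma volume_setOf_inner_eq_one (f : ℂ) : volume {x : ℂ | ⟪f, x⟫ = 1} = 0 := by
  by_cases hne : {x : ℂ | ⟪f, x⟫ = 1}.Nonempty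
  · obtain ⟨a, ha⟩ := hne
    have ha' : ⟪f, a⟫ = 1 := ha
    have hk : (innerSL ℝ f : ℂ →L[ℝ] ℝ).ker ≠ ⊤ := by
      intro h
      have : a ∈ (innerSL ℝ f : ℂ →L[ℝ] ℝ).ker := h ▸ Submodule.mem_top
      rw [LinearMap.mem_ker] at this
      simp [ha'] at this
    have := Measure.addHaar_submodule volume _ hk
    rw [← measure_vadd volume a] at this
    refine measure_mono_null ?_ this
    intro x hx
    have hx' : ⟪f, x⟫ = 1 := hx
    refine ⟨x - a, ?_, by simp⟩
    simp [inner_sub_right, hx', ha']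
  · rw [Set.not_nonempty_iff_eq_empty.1 hne, measure_empty]

lemma convex_setOf_inner_le (f : ℂ) (r : ℝ) : Convex ℝ {x : ℂ | ⟪f, x⟫ ≤ r} :=
  convex_halfSpace_le (innerSL ℝ f : ℂ →L[ℝ] ℝ).toLinearMap.isLinear r

lemma convex_setOf_le_inner (f : ℂ) (r : ℝ) : Convex ℝ {x : ℂ | r ≤ ⟪f, x⟫} :=
  convex_halfSpace_ge (innerSL ℝ f : ℂ →L[ℝ] ℝ).toLinearMap.isLinear r

/-- Adding to a part of a convex set lying below a line a triangle lying above it. -/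
lemma area_add_triangle_le {A C : Set ℂ} (hC : Convex ℝ C) (hfin : volume C ≠ ⊤) (hAC : A ⊆ C)
    {f a b w : ℂ} (hA : ∀ x ∈ A, ⟪f, x⟫ ≤ 1) (ha : a ∈ C) (hb : b ∈ C) (hw : w ∈ C)
    (hfa : ⟪f, a⟫ = 1) (hfb : ⟪f, b⟫ = 1) (hfw : 1 ≤ ⟪f, w⟫) :
    area A + (⟪f, w⟫ - 1) * area (convexHull ℝ {0, a, b}) ≤ area C := by
  rw [← area_triangle_beyond f a b w hfa hfb hfw]
  have hBC : convexHull ℝ {a, b, w} ⊆ C := convexHull_min (by grind) hC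
  have hB : convexHull ℝ {a, b, w} ⊆ {x | 1 ≤ ⟪f, x⟫} :=
    convexHull_min (by rintro x (rfl | rfl | rfl) <;> simp only [Set.mem_ofPred_eq] <;> linarith) (convex_setOf_le_inner f 1)
  have hmeas : MeasurableSet (convexHull ℝ {a, b, w}) :=
    (Set.Finite.isCompact_convexHull ℝ (Set.toFinite _)).isClosed.measurableSet
  have hdisj : AEDisjoint volume A (convexHull ℝ {a, b, w}) :=
    measure_mono_null (fun x hx => le_antisymm (hA x hx.1) (hB hx.2))
      (volume_setOf_inner_eq_one f)
  unfold area
  rw [← ENNReal.toReal_add (measure_ne_top_of_subset hAC hfin)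
    (measure_ne_top_of_subset hBC hfin), ← measure_union₀ hmeas.nullMeasurableSet hdisj]
  exact ENNReal.toReal_mono hfin (measure_mono (Set.union_subset hAC hBC))

end Triangle

section Sector

lemma convex_combination_mem {C : Set ℂ} (hC : Convex ℝ C) {r s t : ℝ} (hr : 0 ≤ r) (hs : 0 ≤ s)
    (ht : 0 ≤ t) (h : r + s + t = 1) {x y z : ℂ} (hx : x ∈ C) (hy : y ∈ C) (hz : z ∈ C) :
    r • x + s • y + t • z ∈ C := by
  have := hC.sum_mem (t := Finset.univ) (w := ![r, s, t]) (z := ![x, y, z])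
    (by intro i _; fin_cases i <;> simp [*]) (by simp [Fin.sum_univ_three, h])
    (by intro i _; fin_cases i <;> simp [*])
  simpa [Fin.sum_univ_three] using this

/-- The linear-algebraic data of a sector and its dual sector. -/
structure SectorPair (u v us vs p ps : ℂ) (lam mu : ℝ) : Prop where
  lam_pos : 0 < lam
  mu_pos : 0 < mu
  one_lt : 1 < lam + mu
  p_eq : p = lam • u + mu • v
  ps_eq : ps = mu • us + lam • vs
  us_u : ⟪us, u⟫ = 1
  vs_v : ⟪vs, v⟫ = 1
  us_p : ⟪us, p⟫ = 1
  vs_p : ⟪vs, p⟫ = 1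
  ps_u : ⟪ps, u⟫ = 1
  ps_v : ⟪ps, v⟫ = 1
  cross : crossForm u v ≠ 0
  crosss : crossForm us vs ≠ 0

namespace SectorPair

variable {u v us vs p ps : ℂ} {lam mu : ℝ}

lemma swap (D : SectorPair u v us vs p ps lam mu) : SectorPair us vs u v ps p mu lam where
  lam_pos := D.mu_pos
  mu_pos := D.lam_pos
  one_lt := by linarith [D.one_lt]
  p_eq := D.ps_eq
  ps_eq := D.p_eq
  us_u := by rw [real_inner_comm, D.us_u]
  vs_v := by rw [real_inner_comm, D.vs_v]
  us_p := by rw [real_inner_comm, D.ps_u]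
  vs_p := by rw [real_inner_comm, D.ps_v]
  ps_u := by rw [real_inner_comm, D.us_p]
  ps_v := by rw [real_inner_comm, D.vs_p]
  cross := D.crosss
  crosss := D.cross

lemma ps_p (D : SectorPair u v us vs p ps lam mu) : ⟪ps, p⟫ = lam + mu := by
  rw [D.p_eq, inner_add_right, inner_smul_right, inner_smul_right, D.ps_u, D.ps_v]
  ring

lemma us_v_lt (D : SectorPair u v us vs p ps lam mu) : ⟪us, v⟫ < 1 := by
  have h := D.us_p
  rw [D.p_eq, inner_add_right, inner_smul_right, inner_smul_right, D.us_u] at h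
  nlinarith [D.mu_pos, D.one_lt]

lemma vs_u_lt (D : SectorPair u v us vs p ps lam mu) : ⟪vs, u⟫ < 1 := by
  have h := D.vs_p
  rw [D.p_eq, inner_add_right, inner_smul_right, inner_smul_right, D.vs_v] at h
  nlinarith [D.lam_pos, D.one_lt]

lemma area_pos (D : SectorPair u v us vs p ps lam mu) : 0 < area (convexHull ℝ {0, u, v}) := by
  rw [area_convexHull_triple, sub_zero, sub_zero]
  exact mul_pos (abs_pos.2 D.cross) area_standard_triangle_pos

lemma exists_coord (D : SectorPair u v us vs p ps lam mu) (z : ℂ) :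
    ∃ x y : ℝ, z = x • u + y • v := by
  have h := D.cross
  refine ⟨crossForm z v / crossForm u v, crossForm u z / crossForm u v, ?_⟩
  apply Complex.ext <;> simp <;> field_simp <;> simp [crossForm] <;> ring

lemma mem_convexHull_of_one_lt (D : SectorPair u v us vs p ps lam mu) {z : ℂ}
    (h1 : ⟪us, z⟫ ≤ 1) (h2 : ⟪vs, z⟫ ≤ 1) (h3 : 1 < ⟪ps, z⟫) :
    z ∈ convexHull ℝ {u, v, p} := by
  obtain ⟨x, y, hz⟩ := D.exists_coord z
  have hS : 0 < lam + mu - 1 := by linarith [D.one_lt]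
  obtain ⟨t, ht⟩ : ∃ t, t * (lam + mu - 1) = x + y - 1 :=
    ⟨(x + y - 1) / (lam + mu - 1), by field_simp⟩
  have hz' : z = (x - t * lam) • u + (y - t * mu) • v + t • p := by
    rw [hz, D.p_eq]; module
  have hps : ⟪ps, z⟫ = x + y := by
    rw [hz, inner_add_right, inner_smul_right, inner_smul_right, D.ps_u, D.ps_v]; ring
  have ht0 : 0 ≤ t := by nlinarith
  rw [hz', inner_add_right, inner_add_right, inner_smul_right, inner_smul_right,
    inner_smul_right, D.us_u, D.us_p] at h1
  rw [hz', inner_add_right, inner_add_right, inner_smul_right, inner_smul_right,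
    inner_smul_right, D.vs_v, D.vs_p] at h2
  have hb : 0 ≤ y - t * mu := by nlinarith [D.us_v_lt]
  have ha : 0 ≤ x - t * lam := by nlinarith [D.vs_u_lt]
  rw [hz']
  have hc := convex_convexHull ℝ ({u, v, p} : Set ℂ)
  exact convex_combination_mem hc ha hb ht0 (by linarith) (subset_convexHull ℝ _ (by simp))
    (subset_convexHull ℝ _ (by simp)) (subset_convexHull ℝ _ (by simp))

lemma mul_area_le (D : SectorPair u v us vs p ps lam mu) {C : Set ℂ} (hC : Convex ℝ C)
    (hfin : volume C ≠ ⊤) (h0 : 0 ∈ C) (hu : u ∈ C) (hv : v ∈ C) {w : ℂ} (hw : w ∈ C)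
    (h1 : 1 ≤ ⟪ps, w⟫) : ⟪ps, w⟫ * area (convexHull ℝ {0, u, v}) ≤ area C := by
  have hT : convexHull ℝ {0, u, v} ⊆ C := convexHull_min (by grind) hC
  have hle : convexHull ℝ {0, u, v} ⊆ {x | ⟪ps, x⟫ ≤ 1} :=
    convexHull_min (by
      rintro x (rfl | rfl | rfl) <;> simp only [Set.mem_ofPred_eq, inner_zero_right, D.ps_u, D.ps_v,
        le_refl, zero_le_one]) (convex_setOf_inner_le ps 1)
  have := area_add_triangle_le hC hfin hT hle hu hv hw D.ps_u D.ps_v h1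
  linarith

lemma mem_convexHull_cases (D : SectorPair u v us vs p ps lam mu) {z : ℂ}
    (hz : z ∈ convexHull ℝ {0, u, v, p}) :
    ⟪us, z⟫ ≤ 1 ∧ ⟪vs, z⟫ ≤ 1 ∧ ⟪ps, z⟫ ≤ lam + mu ∧
      ∃ x y : ℝ, 0 ≤ x ∧ 0 ≤ y ∧ z = x • u + y • v := by
  have h1 := D.one_lt
  refine ⟨?_, ?_, ?_, ?_⟩
  · refine convexHull_min ?_ (convex_setOf_inner_le us 1) hz
    rintro x (rfl | rfl | rfl | rfl) <;>
      simp only [Set.mem_ofPred_eq, inner_zero_right, D.us_u, D.us_p, D.us_v_lt.le, le_refl,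
        zero_le_one]
  · refine convexHull_min ?_ (convex_setOf_inner_le vs 1) hz
    rintro x (rfl | rfl | rfl | rfl) <;>
      simp only [Set.mem_ofPred_eq, inner_zero_right, D.vs_v, D.vs_p, D.vs_u_lt.le, le_refl,
        zero_le_one]
  · refine convexHull_min ?_ (convex_setOf_inner_le ps (lam + mu)) hz
    rintro x (rfl | rfl | rfl | rfl) <;>
      simp only [Set.mem_ofPred_eq, inner_zero_right, D.ps_u, D.ps_v, D.ps_p] <;> linarith
  · have hcone : Convex ℝ {z : ℂ | ∃ x y : ℝ, 0 ≤ x ∧ 0 ≤ y ∧ z = x • u + y • v} := by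
      rintro _ ⟨x, y, hx, hy, rfl⟩ _ ⟨x', y', hx', hy', rfl⟩ a b ha hb -
      exact ⟨a * x + b * x', a * y + b * y', by positivity, by positivity, by module⟩
    refine convexHull_min ?_ hcone hz
    rintro x (hx | hx | hx | hx)
    · exact ⟨0, 0, le_rfl, le_rfl, by simp [hx]⟩
    · exact ⟨1, 0, zero_le_one, le_rfl, by simp [hx]⟩
    · exact ⟨0, 1, le_rfl, zero_le_one, by simp [hx]⟩
    · exact ⟨lam, mu, D.lam_pos.le, D.mu_pos.le, hx.trans D.p_eq⟩

lemma mem_smul_triangle (D : SectorPair u v us vs p ps lam mu) {z : ℂ}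
    (hz : z ∈ convexHull ℝ {0, u, v, p}) {r : ℝ} (hr : 0 < r) (h : ⟪ps, z⟫ ≤ r) :
    z ∈ r • convexHull ℝ {0, u, v} := by
  obtain ⟨-, -, -, x, y, hx, hy, rfl⟩ := D.mem_convexHull_cases hz
  rw [inner_add_right, inner_smul_right, inner_smul_right, D.ps_u, D.ps_v] at h
  rw [Set.mem_smul_set_iff_inv_smul_mem₀ hr.ne']
  have hle : (x + y) / r ≤ 1 := (div_le_one hr).2 (by linarith)
  have := convex_combination_mem (convex_convexHull ℝ ({0, u, v} : Set ℂ))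
    (r := 1 - (x + y) / r) (s := x / r) (t := y / r) (by linarith) (by positivity)
    (by positivity) (by ring) (subset_convexHull ℝ _ (by simp : (0 : ℂ) ∈ _))
    (subset_convexHull ℝ _ (by simp : u ∈ _)) (subset_convexHull ℝ _ (by simp : v ∈ _))
  convert this using 1
  rw [div_eq_inv_mul, div_eq_inv_mul x, div_eq_inv_mul y]
  module

lemma area_quadrilateral_le (D : SectorPair u v us vs p ps lam mu) :
    area (convexHull ℝ {0, u, v, p}) ≤ (lam + mu) * area (convexHull ℝ {0, u, v}) := by
  have hsub : convexHull ℝ {0, u, v, p} ⊆ convexHull ℝ {0, u, v} ∪ convexHull ℝ {u, v, p} := by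
    intro z hz
    obtain ⟨h1, h2, -⟩ := D.mem_convexHull_cases hz
    rcases le_or_gt ⟪ps, z⟫ 1 with h | h
    · left
      simpa using D.mem_smul_triangle hz one_pos h
    · exact Or.inr (D.mem_convexHull_of_one_lt h1 h2 h)
  have hfin (a b c : ℂ) : volume (convexHull ℝ {a, b, c}) ≠ ⊤ :=
    (Set.Finite.isCompact_convexHull ℝ (Set.toFinite _)).measure_lt_top.ne
  have hpos := area_triangle_beyond ps u v p D.ps_u D.ps_v (by rw [D.ps_p]; exact D.one_lt.le)
  rw [D.ps_p] at hpos
  calc area (convexHull ℝ {0, u, v, p})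
      ≤ area (convexHull ℝ {0, u, v}) + area (convexHull ℝ {u, v, p}) := by
        unfold area
        rw [← ENNReal.toReal_add (hfin _ _ _) (hfin _ _ _)]
        exact ENNReal.toReal_mono (ENNReal.add_ne_top.2 ⟨hfin _ _ _, hfin _ _ _⟩)
          ((measure_mono hsub).trans (measure_union_le _ _))
    _ = (lam + mu) * area (convexHull ℝ {0, u, v}) := by rw [hpos]; ring

/-- A functional in the segment from `us` to `ps` whose maximum over the sector of `K` is at most
`c` gives a point of the dual sector after division by `c`. -/
lemma inv_smul_mem_dual_sector (D : SectorPair u v us vs p ps lam mu) {K : Set ℂ}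
    (hK : ∀ z ∈ K, ⟪us, z⟫ ≤ 1 ∧ ⟪vs, z⟫ ≤ 1) {t c : ℝ} (ht0 : 0 ≤ t) (ht1 : t ≤ 1) (hc : 1 ≤ c)
    (h : ∀ z ∈ K ∩ convexHull ℝ {0, u, v, p}, ⟪(1 - t) • us + t • ps, z⟫ ≤ c) :
    c⁻¹ • ((1 - t) • us + t • ps) ∈ polarBody K ∩ convexHull ℝ {0, us, vs, ps} := by
  have hc0 : 0 < c := by linarith
  constructor
  · intro z hz
    rw [real_inner_smul_left, inv_mul_le_iff₀ hc0, mul_one]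
    rcases le_or_gt ⟪ps, z⟫ 1 with h1 | h1
    · rw [inner_add_left, real_inner_smul_left, real_inner_smul_left]
      nlinarith [(hK z hz).1]
    · refine h z ⟨hz, ?_⟩
      exact convexHull_mono (by grind) (D.mem_convexHull_of_one_lt (hK z hz).1 (hK z hz).2 h1)
  · have hc1 : c⁻¹ ≤ 1 := inv_le_one_of_one_le₀ hc
    have := convex_combination_mem (convex_convexHull ℝ ({0, us, vs, ps} : Set ℂ))
      (r := 1 - c⁻¹) (s := c⁻¹ * (1 - t)) (t := c⁻¹ * t) (by linarith)
      (mul_nonneg (by positivity) (by linarith)) (by positivity) (by ring)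
      (subset_convexHull ℝ _ (by simp : (0 : ℂ) ∈ _))
      (subset_convexHull ℝ _ (by simp : us ∈ _)) (subset_convexHull ℝ _ (by simp : ps ∈ _))
    convert this using 1
    module

/-- If `C` contains `[o,u,v]` and `p / M`, and its area barely exceeds that of `[o,u,p/M,v]`, then
`C` barely exceeds the half-plane bounded by the line through `u` and `p / M`. -/
lemma excess_le (D : SectorPair u v us vs p ps lam mu) {C : Set ℂ} (hC : Convex ℝ C)
    (hcomp : volume C ≠ ⊤) (h0 : 0 ∈ C) (hu : u ∈ C) (hv : v ∈ C)
    {M ε : ℝ} (hM : 1 ≤ M) (hMS : M ≤ lam + mu) (hp : M⁻¹ • p ∈ C) (hε : 0 ≤ ε)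
    (harea : M * area C ≤ (1 + ε) * (lam + mu) * area (convexHull ℝ {0, u, v}))
    {t : ℝ} (ht : t * (lam + mu - 1) = M - 1) {w : ℂ} (hw : w ∈ C) :
    mu * (⟪(1 - t) • us + t • ps, w⟫ - 1) ≤ ε * (lam + mu) := by
  have hS := D.one_lt
  have hmu := D.mu_pos
  have hM0 : 0 < M := by linarith
  have ht0 : 0 ≤ t := by nlinarith
  have ht1 : t ≤ 1 := by nlinarith
  set q := (1 - t) • us + t • ps with hq
  have hqu : ⟪q, u⟫ = 1 := by
    rw [hq, inner_add_left, real_inner_smul_left, real_inner_smul_left, D.us_u, D.ps_u]; ring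
  have hqv : ⟪q, v⟫ ≤ 1 := by
    rw [hq, inner_add_left, real_inner_smul_left, real_inner_smul_left, D.ps_v]
    nlinarith [D.us_v_lt]
  have hqp : ⟪q, M⁻¹ • p⟫ = 1 := by
    have : ⟪q, p⟫ = M := by
      rw [hq, inner_add_left, real_inner_smul_left, real_inner_smul_left, D.us_p, D.ps_p]
      linarith
    rw [inner_smul_right, this, inv_mul_cancel₀ hM0.ne']
  rcases le_or_gt 1 ⟪q, w⟫ with h | h
  swap
  · have : 0 ≤ ε * (lam + mu) := mul_nonneg hε (by linarith)
    nlinarith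
  set A := C ∩ {x | ⟪q, x⟫ ≤ 1} with hA
  have hAC : A ⊆ C := Set.inter_subset_left
  have h1 := area_add_triangle_le hC hcomp hAC (fun x hx => hx.2) hu hp hw hqu hqp h
  have hpsp : ⟪ps, M⁻¹ • p⟫ = (lam + mu) / M := by
    rw [inner_smul_right, D.ps_p]; ring
  have h2 := D.mul_area_le (hC.inter (convex_setOf_inner_le q 1))
    (measure_ne_top_of_subset hAC hcomp) ⟨h0, by simp⟩ ⟨hu, hqu.le⟩ ⟨hv, hqv⟩ ⟨hp, hqp.le⟩
    (by rw [hpsp, one_le_div hM0]; exact hMS)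
  rw [hpsp] at h2
  have h3 : area (convexHull ℝ {0, u, M⁻¹ • p}) = mu / M * area (convexHull ℝ {0, u, v}) := by
    rw [area_convexHull_triple, area_convexHull_triple 0 u v]
    have : crossForm (u - 0) (M⁻¹ • p - 0) = mu / M * crossForm (u - 0) (v - 0) := by
      rw [D.p_eq]
      simp [crossForm]
      ring
    rw [this, abs_mul, abs_of_pos (div_pos hmu hM0), mul_assoc]
  rw [h3] at h1
  have hT := D.area_pos
  set T := area (convexHull ℝ {0, u, v})
  have h4 : (lam + mu) * T + (⟪q, w⟫ - 1) * mu * T ≤ M * area C := by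
    have := mul_le_mul_of_nonneg_left (add_le_add_left h2 ((⟪q, w⟫ - 1) * (mu / M * T)) |>.trans h1)
      hM0.le
    calc _ = M * ((lam + mu) / M * T + (⟪q, w⟫ - 1) * (mu / M * T)) := by field_simp
      _ ≤ _ := this
  have h5 := h4.trans harea
  have h6 : (mu * (⟪q, w⟫ - 1)) * T ≤ (ε * (lam + mu)) * T := by linarith
  exact le_of_mul_le_mul_right h6 hT

end SectorPair

lemma mem_of_forall_polarBody {K : Set ℂ} (hc : Convex ℝ K) (hcl : IsClosed K) (h0 : 0 ∈ K)
    {x : ℂ} (hx : ∀ y ∈ polarBody K, ⟪y, x⟫ ≤ 1) : x ∈ K := by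
  by_contra hxK
  obtain ⟨f, s, hf, hs⟩ := geometric_hahn_banach_closed_point hc hcl hxK
  have hs0 : 0 < s := by simpa using hf 0 h0
  set g := (InnerProductSpace.toDual ℝ ℂ).symm f with hg
  have hgf (z : ℂ) : ⟪g, z⟫ = f z := InnerProductSpace.toDual_symm_apply
  have := hx (s⁻¹ • g) (fun z hz => by
    rw [real_inner_smul_left, hgf, inv_mul_le_iff₀ hs0, mul_one]
    exact (hf z hz).le)
  rw [real_inner_smul_left, hgf, inv_mul_le_iff₀ hs0, mul_one] at this
  linarith

lemma polarBody_eq_iInter (K : Set ℂ) : polarBody K = ⋂ y ∈ K, {x | ⟪y, x⟫ ≤ 1} := by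
  ext x
  simp only [polarBody, Set.mem_ofPred_eq, Set.mem_iInter, real_inner_comm x]

lemma convex_polarBody (K : Set ℂ) : Convex ℝ (polarBody K) := by
  rw [polarBody_eq_iInter]
  exact convex_iInter₂ fun y _ => convex_setOf_inner_le y 1

lemma isClosed_polarBody (K : Set ℂ) : IsClosed (polarBody K) := by
  rw [polarBody_eq_iInter]
  exact isClosed_biInter fun y _ => isClosed_le (by fun_prop) continuous_const

lemma exists_max_inner {C : Set ℂ} (hC : IsCompact C) (hne : C.Nonempty) (f : ℂ) :
    ∃ z ∈ C, ∀ x ∈ C, ⟪f, x⟫ ≤ ⟪f, z⟫ := by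
  have hf : ContinuousOn (fun x : ℂ => ⟪f, x⟫) C := by fun_prop
  obtain ⟨z, hz, hmax⟩ := hC.exists_isMaxOn hne hf
  exact ⟨z, hz, fun x hx => hmax hx⟩

/-- The scalar estimate behind the stability of the sector lemma. -/
lemma sub_one_le_of_mul_le {S k ε m M : ℝ} (hS : 1 < S) (hm : 1 ≤ m) (hM : √S ≤ M)
    (h : (M - 1) * (m - 1) ≤ 3 * k * ε * (S - 1)) : m ≤ 1 + 3 * k * (1 + √S) * ε := by
  have hr : 1 < √S := Real.lt_sqrt_of_sq_lt (by linarith)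
  have hsq : √S * √S = S := Real.mul_self_sqrt (by linarith)
  have h1 : (√S - 1) * (m - 1) ≤ (√S - 1) * (3 * k * (1 + √S) * ε) := by
    calc _ ≤ (M - 1) * (m - 1) := by nlinarith
      _ ≤ _ := h
      _ = _ := by linear_combination (-3 * k * ε) * hsq
  have := le_of_mul_le_mul_left h1 (by linarith)
  linarith

lemma crossForm_ne_zero {x y : ℂ} (h : LinearIndependent ℝ ![x, y]) : crossForm x y ≠ 0 := by
  intro hc
  rw [LinearIndependent.pair_iff] at h
  unfold crossForm at hc
  have h1 := h y.im (-x.im) (by apply Complex.ext <;> simp <;> linarith)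
  have h2 := h y.re (-x.re) (by apply Complex.ext <;> simp <;> linarith)
  have hx : x = 0 := Complex.ext (by simpa using h2.2) (by simpa using h1.2)
  have := h 1 0 (by simp [hx])
  norm_num at this

lemma eq_of_inner_eq {x y a b : ℂ} (h : crossForm a b ≠ 0) (ha : ⟪x, a⟫ = ⟪y, a⟫)
    (hb : ⟪x, b⟫ = ⟪y, b⟫) : x = y := by
  simp only [inner_eq_re_im] at ha hb
  apply Complex.ext <;> apply mul_right_cancel₀ h <;> unfold crossForm
  · linear_combination b.im * ha - a.im * hb
  · linear_combination a.re * hb - b.re * ha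

lemma sectorPair_of_support {u v us vs p ps : ℂ} {lam mu : ℝ} (hlam : 0 < lam) (hmu : 0 < mu)
    (huv : LinearIndependent ℝ ![u, v]) (husvs : LinearIndependent ℝ ![us, vs])
    (husu : ⟪us, u⟫ = 1) (hvsv : ⟪vs, v⟫ = 1) (husv : ⟪us, v⟫ ≤ 1)
    (hp : ⟪us, p⟫ = 1 ∧ ⟪vs, p⟫ = 1) (hps : ⟪ps, u⟫ = 1 ∧ ⟪ps, v⟫ = 1)
    (hpdef : p = lam • u + mu • v) : SectorPair u v us vs p ps lam mu := by
  have h1 := crossForm_ne_zero huv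
  have h2 := crossForm_ne_zero husvs
  have e1 : lam + mu * ⟪us, v⟫ = 1 := by
    have := hp.1
    rw [hpdef, inner_add_right, inner_smul_right, inner_smul_right, husu] at this
    linarith
  have e2 : lam * ⟪vs, u⟫ + mu = 1 := by
    have := hp.2
    rw [hpdef, inner_add_right, inner_smul_right, inner_smul_right, hvsv] at this
    linarith
  have gram : crossForm us vs * crossForm u v = 1 - ⟪us, v⟫ * ⟪vs, u⟫ := by
    have : crossForm us vs * crossForm u v = ⟪us, u⟫ * ⟪vs, v⟫ - ⟪us, v⟫ * ⟪vs, u⟫ := by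
      simp only [inner_eq_re_im, crossForm]; ring
    rw [this, husu, hvsv, one_mul]
  have hge : 1 ≤ lam + mu := by nlinarith
  refine ⟨hlam, hmu, lt_of_le_of_ne hge ?_, hpdef, ?_, husu, hvsv, hp.1, hp.2, hps.1, hps.2, h1, h2⟩
  · intro h
    have a1 : ⟪us, v⟫ = 1 := mul_left_cancel₀ hmu.ne' (by linarith)
    have b1 : ⟪vs, u⟫ = 1 := mul_left_cancel₀ hlam.ne' (by linarith)
    rw [a1, b1] at gram
    exact mul_ne_zero h2 h1 (by linarith)
  · refine eq_of_inner_eq h1 ?_ ?_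
    · rw [inner_add_left, real_inner_smul_left, real_inner_smul_left, husu, hps.1]; linarith
    · rw [inner_add_left, real_inner_smul_left, real_inner_smul_left, hvsv, hps.2]; linarith

lemma le_three_mul_of_excess {lam mu k ε c τ : ℝ} (hτ : 0 ≤ τ) (hc1 : 1 ≤ c) (hε : 0 ≤ ε)
    (hlam : 0 < lam) (hmu : 0 < mu) (hkl : lam + mu ≤ k * lam) (hkm : lam + mu ≤ k * mu)
    (hkε : k * ε ≤ 1) (h1 : mu * (c - 1) ≤ ε * (lam + mu))
    (h2 : lam * (c⁻¹ * (1 + τ) - 1) ≤ ε * (lam + mu)) : τ ≤ 3 * k * ε := by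
  have hc0 : 0 < c := by linarith
  have hc : c - 1 ≤ k * ε := by
    refine le_of_mul_le_mul_left ?_ hmu
    linarith [mul_le_mul_of_nonneg_left hkm hε]
  obtain ⟨d, hd⟩ : ∃ d, c⁻¹ * (1 + τ) = d := ⟨_, rfl⟩
  rw [hd] at h2
  have hd1 : d - 1 ≤ k * ε := by
    refine le_of_mul_le_mul_left ?_ hlam
    linarith [mul_le_mul_of_nonneg_left hkl hε]
  have hd0 : 0 ≤ d := by rw [← hd]; positivity
  have hcd : 1 + τ = c * d := by
    rw [← hd]; field_simp
  have hcd' : c * d ≤ (1 + k * ε) * (1 + k * ε) :=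
    mul_le_mul (by linarith) (by linarith) hd0 (by linarith)
  have : (k * ε) * (k * ε) ≤ k * ε * 1 := mul_le_mul_of_nonneg_left hkε (by linarith)
  linarith

/-- The key estimate: if the product of the areas of the two sectors is almost minimal, then the
maximum `m` of `ps` on `C` or the maximum `M` of `p` on `Cs` is close to `1`. -/
lemma SectorPair.sub_one_mul_sub_one_le {u v us vs p ps : ℂ} {lam mu : ℝ}
    (D : SectorPair u v us vs p ps lam mu) {C Cs : Set ℂ} (hC : Convex ℝ C) (hCs : Convex ℝ Cs)
    (hcomp : IsCompact C) (hcomps : IsCompact Cs) (h0 : 0 ∈ C) (hu : u ∈ C) (hv : v ∈ C)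
    (h0s : 0 ∈ Cs) (hus : us ∈ Cs) (hvs : vs ∈ Cs)
    {z₀ y₀ : ℂ} (hz₀ : z₀ ∈ C) (hy₀ : y₀ ∈ Cs) {m M : ℝ} (hmz : ⟪ps, z₀⟫ = m) (hMy : ⟪p, y₀⟫ = M)
    (hm1 : 1 ≤ m) (hM1 : 1 ≤ M) (hmS : m ≤ lam + mu) (hMS : M ≤ lam + mu)
    (hpC : M⁻¹ • p ∈ C) (hpsCs : m⁻¹ • ps ∈ Cs)
    (hdual : ∀ t c : ℝ, 0 ≤ t → t ≤ 1 → 1 ≤ c → (∀ z ∈ C, ⟪(1 - t) • us + t • ps, z⟫ ≤ c) →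
      c⁻¹ • ((1 - t) • us + t • ps) ∈ Cs)
    {ε k : ℝ} (hε : 0 ≤ ε) (hkl : lam + mu ≤ k * lam) (hkm : lam + mu ≤ k * mu) (hkε : k * ε ≤ 1)
    (harea : area C * area Cs ≤ (1 + ε) * ((lam + mu) * area (convexHull ℝ {0, u, v}) *
      area (convexHull ℝ {0, us, vs}))) :
    (M - 1) * (m - 1) ≤ 3 * k * ε * (lam + mu - 1) := by
  have hT := D.area_pos
  have hTs := D.swap.area_pos
  have hlow := D.mul_area_le hC hcomp.measure_lt_top.ne h0 hu hv hz₀ (by rwa [hmz])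
  have hlows := D.swap.mul_area_le hCs hcomps.measure_lt_top.ne h0s hus hvs hy₀ (by rwa [hMy])
  rw [hmz] at hlow
  rw [hMy] at hlows
  set T := area (convexHull ℝ {0, u, v})
  set Ts := area (convexHull ℝ {0, us, vs})
  have hS := D.one_lt
  have hS0 : 0 < lam + mu - 1 := by linarith
  have hlam := D.lam_pos
  have hmu := D.mu_pos
  have hup : M * area C ≤ (1 + ε) * (lam + mu) * T := by
    refine le_of_mul_le_mul_right ?_ hTs
    have := mul_le_mul_of_nonneg_left hlows (area_nonneg C)
    linarith
  have hups : m * area Cs ≤ (1 + ε) * (mu + lam) * Ts := by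
    refine le_of_mul_le_mul_right ?_ hT
    have := mul_le_mul_of_nonneg_right hlow (area_nonneg Cs)
    linarith
  obtain ⟨t, ht⟩ : ∃ t, t * (lam + mu - 1) = M - 1 :=
    ⟨(M - 1) / (lam + mu - 1), div_mul_cancel₀ _ (by linarith)⟩
  obtain ⟨r, hr⟩ : ∃ r, r * (lam + mu - 1) = m - 1 :=
    ⟨(m - 1) / (lam + mu - 1), div_mul_cancel₀ _ (by linarith)⟩
  have ht0 : 0 ≤ t := by nlinarith
  have ht1 : t ≤ 1 := by nlinarith
  obtain ⟨w, hw, hwmax⟩ := exists_max_inner hcomp ⟨0, h0⟩ ((1 - t) • us + t • ps)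
  have hex := D.excess_le hC hcomp.measure_lt_top.ne h0 hu hv hM1 hMS hpC hε hup ht hw
  set q := (1 - t) • us + t • ps with hq
  have hqu : ⟪q, u⟫ = 1 := by
    rw [hq, inner_add_left, real_inner_smul_left, real_inner_smul_left, D.us_u, D.ps_u]; ring
  have hc1 : 1 ≤ ⟪q, w⟫ := hqu ▸ hwmax u hu
  have hws := hdual t ⟪q, w⟫ ht0 ht1 hc1 hwmax
  have hexs := D.swap.excess_le hCs hcomps.measure_lt_top.ne h0s hus hvs hm1 (by linarith) hpsCs hε
    hups (t := r) (by linarith) hws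
  set c := ⟪q, w⟫
  have hlq : ⟪(1 - r) • u + r • p, q⟫ = 1 + t * r * (lam + mu - 1) := by
    rw [hq]
    simp only [inner_add_left, inner_add_right, real_inner_smul_left, inner_smul_right,
      D.swap.us_u, D.swap.us_p, D.swap.ps_u, D.swap.ps_p]
    ring
  rw [inner_smul_right, hlq] at hexs
  have hr0 : 0 ≤ r := by nlinarith
  have htau := le_three_mul_of_excess (by positivity) hc1 hε hlam hmu hkl hkm hkε hex
    (hexs.trans_eq (by rw [add_comm]))
  calc (M - 1) * (m - 1) = (t * r * (lam + mu - 1)) * (lam + mu - 1) := by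
        rw [← ht, ← hr]; ring
    _ ≤ _ := mul_le_mul_of_nonneg_right htau hS0.le

end Sector

/-- Stability version of the sector lemma: if `p = λu + μv` with `λ, μ > 0` and
`|C|·|C*| ≤ (1+ε)·|[o,u,v,p]|·|[o,u*,v*]|` with `0 < ε < min{λ,μ}/(λ+μ)`, then for
`γ = 3·[(λ+μ)/min{λ,μ}]·(1+√(λ+μ))`, either `C ⊆ (1+γε)·[o,u,v]`, or
`(1+γε)⁻¹·[o,u,v,p] ⊆ C`, that is, `C* ⊆ (1+γε)·[o,u*,v*]`. -/
theorem sector_lemma_stability (K : Set ℂ) (hK : IsConvexBody K)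
    (ho : (0 : ℂ) ∈ interior K) (u v us vs p ps : ℂ)
    (huv : LinearIndependent ℝ ![u, v])
    (hu : u ∈ frontier K) (hv : v ∈ frontier K)
    (husvs : LinearIndependent ℝ ![us, vs])
    (hus : us ∈ frontier (polarBody K)) (hvs : vs ∈ frontier (polarBody K))
    (husu : ⟪us, u⟫ = 1) (hvsv : ⟪vs, v⟫ = 1)
    (hsupp : ∀ y ∈ K, ⟪us, y⟫ ≤ 1 ∧ ⟪vs, y⟫ ≤ 1)
    (hp : ⟪us, p⟫ = 1 ∧ ⟪vs, p⟫ = 1)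
    (hpseg : (segment ℝ p 0 ∩ segment ℝ u v).Nonempty)
    (hps : ⟪ps, u⟫ = 1 ∧ ⟪ps, v⟫ = 1)
    (hpsseg : (segment ℝ ps 0 ∩ segment ℝ us vs).Nonempty)
    (C Cs : Set ℂ)
    (hC : C = K ∩ convexHull ℝ {0, u, v, p})
    (hCs : Cs = polarBody K ∩ convexHull ℝ {0, us, vs, ps})
    (lam mu : ℝ) (hlam : 0 < lam) (hmu : 0 < mu)
    (hpdef : p = lam • u + mu • v)
    (ε γ : ℝ) (hε : 0 < ε) (hεsmall : ε < min lam mu / (lam + mu))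
    (hγ : γ = 3 * ((lam + mu) / min lam mu) * (1 + Real.sqrt (lam + mu)))
    (hCC : area C * area Cs ≤
      (1 + ε) * (area (convexHull ℝ {0, u, v, p}) * area (convexHull ℝ {(0 : ℂ), us, vs}))) :
    C ⊆ (1 + γ * ε) • convexHull ℝ {(0 : ℂ), u, v} ∨
      ((1 + γ * ε)⁻¹ • convexHull ℝ {0, u, v, p} ⊆ C ∧
        Cs ⊆ (1 + γ * ε) • convexHull ℝ {(0 : ℂ), us, vs}) := by
  subst hC hCs
  have hKcl := hK.2.1.isClosed
  have h0K : (0 : ℂ) ∈ K := interior_subset ho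
  have huK : u ∈ K := hKcl.frontier_subset hu
  have hvK : v ∈ K := hKcl.frontier_subset hv
  have husK := (isClosed_polarBody K).frontier_subset hus
  have hvsK := (isClosed_polarBody K).frontier_subset hvs
  have h0P : (0 : ℂ) ∈ polarBody K := fun y _ => by simp
  have D : SectorPair u v us vs p ps lam mu :=
    sectorPair_of_support hlam hmu huv husvs husu hvsv (hsupp v hvK).1 hp hps hpdef
  have hS := D.one_lt
  have hsupps : ∀ y ∈ polarBody K, ⟪u, y⟫ ≤ 1 ∧ ⟪v, y⟫ ≤ 1 := fun y hy =>
    ⟨by rw [real_inner_comm]; exact hy u huK, by rw [real_inner_comm]; exact hy v hvK⟩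
  set C := K ∩ convexHull ℝ {0, u, v, p} with hC
  set Cs := polarBody K ∩ convexHull ℝ {0, us, vs, ps} with hCs
  have hCconv : Convex ℝ C := hK.1.inter (convex_convexHull ℝ _)
  have hCsconv : Convex ℝ Cs := (convex_polarBody K).inter (convex_convexHull ℝ _)
  have hCcomp : IsCompact C :=
    hK.2.1.inter_right (Set.Finite.isCompact_convexHull ℝ (Set.toFinite _)).isClosed
  have hCscomp : IsCompact Cs :=
    (Set.Finite.isCompact_convexHull ℝ (Set.toFinite _)).inter_left (isClosed_polarBody K)
  have h0C : (0 : ℂ) ∈ C := ⟨h0K, subset_convexHull ℝ _ (by simp)⟩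
  have huC : u ∈ C := ⟨huK, subset_convexHull ℝ _ (by simp)⟩
  have hvC : v ∈ C := ⟨hvK, subset_convexHull ℝ _ (by simp)⟩
  have h0Cs : (0 : ℂ) ∈ Cs := ⟨h0P, subset_convexHull ℝ _ (by simp)⟩
  have husCs : us ∈ Cs := ⟨husK, subset_convexHull ℝ _ (by simp)⟩
  have hvsCs : vs ∈ Cs := ⟨hvsK, subset_convexHull ℝ _ (by simp)⟩
  obtain ⟨z₀, hz₀, hm⟩ := exists_max_inner hCcomp ⟨0, h0C⟩ ps
  obtain ⟨y₀, hy₀, hM⟩ := exists_max_inner hCscomp ⟨0, h0Cs⟩ p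
  obtain ⟨m, hmz⟩ : ∃ m, ⟪ps, z₀⟫ = m := ⟨_, rfl⟩
  obtain ⟨M, hMy⟩ : ∃ M, ⟪p, y₀⟫ = M := ⟨_, rfl⟩
  rw [hmz] at hm
  rw [hMy] at hM
  have hm1 : 1 ≤ m := hps.1 ▸ hm u huC
  have hM1 : 1 ≤ M := D.swap.ps_u ▸ hM us husCs
  have hmS : m ≤ lam + mu := hmz ▸ (D.mem_convexHull_cases hz₀.2).2.2.1
  have hMS : M ≤ lam + mu := by
    have := (D.swap.mem_convexHull_cases hy₀.2).2.2.1
    linarith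
  have hdual : ∀ t c : ℝ, 0 ≤ t → t ≤ 1 → 1 ≤ c → (∀ z ∈ C, ⟪(1 - t) • us + t • ps, z⟫ ≤ c) →
      c⁻¹ • ((1 - t) • us + t • ps) ∈ Cs := fun t c h0 h1 hc h =>
    D.inv_smul_mem_dual_sector hsupp h0 h1 hc h
  have hpsCs : m⁻¹ • ps ∈ Cs := by
    simpa using hdual 1 m zero_le_one le_rfl hm1 (by simpa using hm)
  have hpmem : ∀ c : ℝ, M ≤ c → c⁻¹ • p ∈ C := by
    intro c hMc
    have hbi := D.swap.inv_smul_mem_dual_sector hsupps (t := 1) (c := c) zero_le_one le_rfl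
      (hM1.trans hMc) (fun y hy => by
        rw [sub_self, zero_smul, one_smul, zero_add]
        exact (hM y hy).trans hMc)
    rw [sub_self, zero_smul, one_smul, zero_add] at hbi
    refine ⟨mem_of_forall_polarBody hK.1 hKcl h0K fun y hy => ?_, hbi.2⟩
    rw [real_inner_comm]
    exact hbi.1 y hy
  have hmin : 0 < min lam mu := lt_min hlam hmu
  have hT0 := area_nonneg (convexHull ℝ {0, us, vs})
  have hkey := D.sub_one_mul_sub_one_le hCconv hCsconv hCcomp hCscomp h0C huC hvC h0Cs husCs hvsCs
    hz₀ hy₀ hmz hMy hm1 hM1 hmS hMS (hpmem M le_rfl) hpsCs hdual (ε := ε)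
    (k := (lam + mu) / min lam mu) hε.le
    (by rw [div_mul_eq_mul_div, le_div_iff₀ hmin]
        exact mul_le_mul_of_nonneg_left (min_le_left _ _) (by linarith))
    (by rw [div_mul_eq_mul_div, le_div_iff₀ hmin]
        exact mul_le_mul_of_nonneg_left (min_le_right _ _) (by linarith))
    (by rw [div_mul_eq_mul_div, div_le_one hmin]
        rw [lt_div_iff₀ (by linarith)] at hεsmall
        linarith)
    (hCC.trans (mul_le_mul_of_nonneg_left
      (mul_le_mul_of_nonneg_right D.area_quadrilateral_le hT0) (by linarith)))
  have hγ0 : 0 < γ := by rw [hγ]; positivity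
  have hr : 0 < 1 + γ * ε := by positivity
  rcases le_total (√(lam + mu)) M with h | h
  · left
    have hm' := sub_one_le_of_mul_le hS hm1 h hkey
    rw [← hγ] at hm'
    exact fun z hz => D.mem_smul_triangle hz.2 hr ((hm z hz).trans hm')
  · right
    have hmM : lam + mu ≤ m * M := by
      have := hM _ hpsCs
      rw [inner_smul_right, D.swap.ps_p, inv_mul_le_iff₀ (by linarith)] at this
      linarith
    have hmr : √(lam + mu) ≤ m := by
      have hsq : √(lam + mu) * √(lam + mu) = lam + mu := Real.mul_self_sqrt (by linarith)
      have : 0 < √(lam + mu) := Real.sqrt_pos.2 (by linarith)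
      nlinarith
    have hM' := sub_one_le_of_mul_le hS hM1 hmr (by rwa [mul_comm])
    rw [← hγ] at hM'
    refine ⟨?_, fun y hy => D.swap.mem_smul_triangle hy.2 hr ((hM y hy).trans hM')⟩
    have hr1 : (1 + γ * ε)⁻¹ ≤ 1 := inv_le_one_of_one_le₀ (by nlinarith)
    rw [← convexHull_smul]
    refine convexHull_min ?_ hCconv
    rintro _ ⟨x, (hx | hx | hx | hx), rfl⟩
    · simpa [hx] using h0C
    · exact hCconv.smul_mem_of_zero_mem h0C (hx ▸ huC) ⟨by positivity, hr1⟩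
    · exact hCconv.smul_mem_of_zero_mem h0C (hx ▸ hvC) ⟨by positivity, hr1⟩
    · rw [Set.mem_singleton_iff] at hx
      exact hx ▸ hpmem _ hM'
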